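/- The set Π_r of tuples (g_1,...,g_r) ∈ F_q[T]^r with g_r ≠ 0 for which there exists a monic irreducible polynomial l ≠ T with v_l(g_{r-1}) = 0 and p ∤ v_l(g_r), has density 1. -/

import Mathlib

open Polynomial in
theorem aux_decomp {F : Type} [Field F] (p : ℕ) (hp : p ≠ 0) (a : F[X]) (ha : a ≠ 0) :
    ∃ u d : F[X], a = u * d ^ p ∧ ∀ e, e ^ p ∣ u → IsUnit e := by
  induction hm : a.natDegree using Nat.strong_induction_on generalizing a with
  | _ m ih =>
    by_cases h : ∀ e, e ^ p ∣ a → IsUnit e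
    · exact ⟨a, 1, by simp, h⟩
    · push Not at h
      obtain ⟨e, ⟨c, hc⟩, he⟩ := h
      have hc0 : c ≠ 0 := by rintro rfl; simp at hc; exact ha hc
      have he0 : e ^ p ≠ 0 := by intro h0; rw [h0] at hc; simp at hc; exact ha hc
      have hep : e ≠ 0 := by rintro rfl; simp [hp] at he0
      have hd : 0 < e.natDegree := by
        rw [Nat.pos_iff_ne_zero]
        intro h0
        exact he (Polynomial.isUnit_iff_degree_eq_zero.2 (by
          rw [Polynomial.degree_eq_natDegree hep, h0]; rfl))
      have : c.natDegree < m := by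
        rw [← hm, hc, natDegree_mul he0 hc0, natDegree_pow]
        have := Nat.mul_pos (Nat.pos_of_ne_zero hp) hd
        omega
      obtain ⟨u, d, h1, h2⟩ := ih _ this c hc0 rfl
      exact ⟨u, d * e, by rw [hc, h1]; ring, h2⟩

open Polynomial in
theorem aux_val {F : Type} [Field F] (p : ℕ) (hp : p ≠ 0) (a u d : F[X]) (ha : a ≠ 0)
    (had : a = u * d ^ p) (hu : ∀ e, e ^ p ∣ u → IsUnit e) (l : F[X]) (hl : Irreducible l)
    (hlu : l ∣ u) : ∃ k : ℕ, ¬ p ∣ k ∧ l ^ k ∣ a ∧ ¬ l ^ (k + 1) ∣ a := by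
  have hfa : FiniteMultiplicity l a := FiniteMultiplicity.of_prime_left hl.prime ha
  have hd0 : d ^ p ≠ 0 := by rintro h; rw [h] at had; simp at had; exact ha had
  have hdd : d ≠ 0 := by rintro rfl; simp [hp] at hd0
  have hu0 : u ≠ 0 := by rintro rfl; simp at had; exact ha had
  have hfu : FiniteMultiplicity l u := FiniteMultiplicity.of_prime_left hl.prime hu0
  have hfd : FiniteMultiplicity l d := FiniteMultiplicity.of_prime_left hl.prime hdd
  refine ⟨multiplicity l a, ?_, pow_multiplicity_dvd l a,
    hfa.not_pow_dvd_of_multiplicity_lt (Nat.lt_succ_self _)⟩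
  have h1 : multiplicity l a = multiplicity l u + p * multiplicity l d := by
    have hfa' := hfa
    rw [had] at hfa'
    rw [had, multiplicity_mul hl.prime hfa', hfd.multiplicity_pow hl.prime]
  rw [h1, Nat.dvd_add_left (Dvd.intro _ rfl)]
  have h2 : multiplicity l u < p := by
    by_contra h
    push Not at h
    exact hl.not_isUnit (hu l ((pow_dvd_pow l h).trans (pow_multiplicity_dvd l u)))
  have h3 : 0 < multiplicity l u := by
    rw [Nat.pos_iff_ne_zero]
    intro h0
    have := hfu.not_pow_dvd_of_multiplicity_lt (m := 1) (by omega)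
    simp at this
    exact this hlu
  intro h
  exact absurd (Nat.le_of_dvd h3 h) (by omega)

open Polynomial UniqueFactorizationMonoid in
theorem aux_rad {F : Type} [Field F] [DecidableEq F] (p : ℕ) (u : F[X]) (hu0 : u ≠ 0)
    (hu : ∀ e, e ^ p ∣ u → IsUnit e) : u.natDegree ≤ p * (radical u).natDegree := by
  have hr : radical u ≠ 0 := radical_ne_zero
  have h : u ∣ radical u ^ p := by
    rw [dvd_iff_normalizedFactors_le_normalizedFactors hu0 (pow_ne_zero _ hr),
      normalizedFactors_pow, ← primeFactors_val_eq_normalizedFactors isRadical_radical,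
      primeFactors_radical, Multiset.le_iff_count]
    intro l
    by_cases hl : l ∈ normalizedFactors u
    · rw [Multiset.count_nsmul, Multiset.count_eq_one_of_mem (primeFactors u).nodup
        (mem_primeFactors.2 hl), mul_one]
      by_contra h
      push Not at h
      have hli := irreducible_of_normalized_factor l hl
      apply hli.not_isUnit
      apply hu
      rw [pow_dvd_iff_le_emultiplicity, emultiplicity_eq_count_normalizedFactors hli hu0,
        normalize_normalized_factor l hl]
      exact_mod_cast h.le
    · rw [Multiset.count_eq_zero_of_notMem hl]; exact Nat.zero_le _
  have := natDegree_le_of_dvd h (pow_ne_zero _ hr)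
  rwa [natDegree_pow] at this

open Polynomial UniqueFactorizationMonoid in
/-- The key dichotomy. -/
theorem aux_key {F : Type} [Field F] (p : ℕ) (hp : p ≠ 0) (a : F[X]) (ha : a ≠ 0) :
    ∃ u d s : F[X], a = u * d ^ p ∧ s ≠ 0 ∧ u.natDegree ≤ p * s.natDegree ∧
      ∀ b : F[X], (¬ ∃ l : F[X], l.Monic ∧ Irreducible l ∧ l ≠ X ∧ ¬ l ∣ b ∧
        ∃ k : ℕ, ¬ p ∣ k ∧ l ^ k ∣ a ∧ ¬ l ^ (k + 1) ∣ a) → s ∣ X * b := by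
  classical
  obtain ⟨u, d, had, hu⟩ := aux_decomp p hp a ha
  have hu0 : u ≠ 0 := by rintro rfl; simp at had; exact ha had
  refine ⟨u, d, radical u, had, radical_ne_zero, aux_rad p u hu0 hu, ?_⟩
  intro b hb
  by_cases hb0 : X * b = 0
  · rw [hb0]; exact dvd_zero _
  rw [radical_dvd_iff_primeFactors_subset hb0]
  intro l hl
  rw [mem_primeFactors] at hl ⊢
  have hli := irreducible_of_normalized_factor l hl
  have hln := normalize_normalized_factor l hl
  have hlu := dvd_of_mem_normalizedFactors hl
  rw [mem_normalizedFactors_iff' hb0]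
  refine ⟨hli, hln, ?_⟩
  by_cases hX : l = X
  · rw [hX]; exact Dvd.intro _ rfl
  by_contra hlb
  refine hb ⟨l, ?_, hli, hX, fun h => hlb (h.mul_left X), aux_val p hp a u d ha had hu l hli hlu⟩
  rw [← hln]; exact monic_normalize hli.ne_zero

open Polynomial in
/-- Polynomials of degree less than `N`. -/
noncomputable def auxP (F : Type) [Field F] [Fintype F] (N : ℕ) : Finset F[X] :=
  Finset.univ.map ((degreeLTEquiv F N).symm.toEquiv.toEmbedding.trans
    (Function.Embedding.subtype _))

open Polynomial in
theorem auxP_mem {F : Type} [Field F] [Fintype F] (N : ℕ) (f : F[X]) :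
    f ∈ auxP F N ↔ f.degree < N := by
  rw [← mem_degreeLT, auxP]
  simp only [Finset.mem_map, Finset.mem_univ, true_and]
  constructor
  · rintro ⟨v, rfl⟩
    exact ((degreeLTEquiv F N).symm v).2
  · intro h
    exact ⟨degreeLTEquiv F N ⟨f, h⟩, by simp⟩

theorem auxP_card {F : Type} [Field F] [Fintype F] (N : ℕ) :
    (auxP F N).card = Fintype.card F ^ N := by
  simp [auxP]

open Polynomial in
theorem auxP_mem' {F : Type} [Field F] [Fintype F] (N : ℕ) (f : F[X]) (h : f.natDegree < N) :
    f ∈ auxP F N := by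
  rw [auxP_mem]
  exact lt_of_le_of_lt degree_le_natDegree (by exact_mod_cast h)

theorem aux_pi_card {r N : ℕ} {F : Type} [Field F] [Fintype F] (j : Fin r)
    (S : Finset (Polynomial F)) :
    (Fintype.piFinset (Function.update (fun _ : Fin r => auxP F N) j S)).card
      = S.card * Fintype.card F ^ (N * (r - 1)) := by
  classical
  rw [Fintype.card_piFinset, ← Finset.mul_prod_erase _ _ (Finset.mem_univ j),
    Finset.prod_congr rfl (g := fun _ => Fintype.card F ^ N)]
  · simp [Finset.card_erase_of_mem, pow_mul]
  · intro x hx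
    rw [Function.update_of_ne (Finset.ne_of_mem_erase hx), auxP_card]

open Polynomial in
theorem aux_bad {F : Type} [Field F] [Fintype F] (p : ℕ) (hp : 2 ≤ p) (r N M : ℕ)
    (hM : M ≤ N) (i j : Fin r) (hij : i ≠ j) (B : Finset (Fin r → F[X]))
    (hB : ∀ g ∈ B, g j ≠ 0 ∧ (∀ i, (g i).degree < (N : ℕ)) ∧
      ¬ ∃ l : F[X], l.Monic ∧ Irreducible l ∧ l ≠ X ∧ ¬ l ∣ g i ∧
        ∃ k : ℕ, ¬ p ∣ k ∧ l ^ k ∣ g j ∧ ¬ l ^ (k + 1) ∣ g j) :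
    B.card ≤ Fintype.card F ^ (p * M + (N / 2 + 1)) * Fintype.card F ^ (N * (r - 1)) +
      Fintype.card F ^ (N + 1 - M) * Fintype.card F ^ (N * (r - 1)) := by
  classical
  have key : ∀ a : F[X], ∃ u d s : F[X], a ≠ 0 → a = u * d ^ p ∧ s ≠ 0 ∧
      u.natDegree ≤ p * s.natDegree ∧
      ∀ b : F[X], (¬ ∃ l : F[X], l.Monic ∧ Irreducible l ∧ l ≠ X ∧ ¬ l ∣ b ∧
        ∃ k : ℕ, ¬ p ∣ k ∧ l ^ k ∣ a ∧ ¬ l ^ (k + 1) ∣ a) → s ∣ X * b := by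
    intro a
    by_cases ha : a = 0
    · exact ⟨0, 0, 0, fun h => absurd ha h⟩
    · obtain ⟨u, d, s, h⟩ := aux_key p (by omega) a ha
      exact ⟨u, d, s, fun _ => h⟩
  choose u d s hk using key
  rw [← Finset.card_filter_add_card_filter_not (s := B) (fun g => (u (g j)).natDegree < p * M)]
  apply Nat.add_le_add
  · set S : Finset F[X] := (auxP F (p * M) ×ˢ auxP F (N / 2 + 1)).image (fun x => x.1 * x.2 ^ p)
      with hS
    have hSc : S.card ≤ Fintype.card F ^ (p * M + (N / 2 + 1)) := by
      refine Finset.card_image_le.trans ?_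
      rw [Finset.card_product, auxP_card, auxP_card, ← pow_add]
    refine le_trans ?_ (Nat.mul_le_mul_right _ hSc)
    rw [← aux_pi_card j S]
    apply Finset.card_le_card
    intro g hg
    rw [Finset.mem_filter] at hg
    obtain ⟨hgB, hgu⟩ := hg
    obtain ⟨h0, hdeg, hbad⟩ := hB g hgB
    obtain ⟨h1, h2, h3, h4⟩ := hk (g j) h0
    rw [Fintype.mem_piFinset]
    intro x
    by_cases hx : x = j
    · subst hx
      rw [Function.update_self, hS, Finset.mem_image]
      refine ⟨(u (g x), d (g x)), ?_, h1.symm⟩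
      rw [Finset.mem_product]
      refine ⟨auxP_mem' _ _ hgu, auxP_mem' _ _ ?_⟩
      have hu0 : u (g x) ≠ 0 := by intro h; rw [h] at h1; simp at h1; exact h0 h1
      have hd0 : d (g x) ^ p ≠ 0 := by intro h; rw [h] at h1; simp at h1; exact h0 h1
      have h5 : (g x).natDegree = (u (g x)).natDegree + p * (d (g x)).natDegree := by
        conv_lhs => rw [h1]
        rw [natDegree_mul hu0 hd0, natDegree_pow]
      have h6 : (g x).natDegree < N := (natDegree_lt_iff_degree_lt h0).2 (hdeg x)
      have h7 : 2 * (d (g x)).natDegree ≤ p * (d (g x)).natDegree := Nat.mul_le_mul_right _ hp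
      show (d (g x)).natDegree < N / 2 + 1
      omega
    · rw [Function.update_of_ne hx, auxP_mem]; exact hdeg x
  · rw [← auxP_card (N + 1 - M), ← aux_pi_card i]
    apply Finset.card_le_card_of_injOn
      (fun g => Function.update g i (X * g i / s (g j)))
    · intro g hg
      rw [Finset.mem_coe, Finset.mem_filter] at hg
      obtain ⟨hgB, hgu⟩ := hg
      obtain ⟨h0, hdeg, hbad⟩ := hB g hgB
      obtain ⟨h1, h2, h3, h4⟩ := hk (g j) h0
      rw [Finset.mem_coe, Fintype.mem_piFinset]
      intro x
      by_cases hx : x = i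
      · subst hx
        rw [Function.update_self]
        show Function.update g x (X * g x / s (g j)) x ∈ _
        rw [Function.update_self]
        obtain ⟨c, hc⟩ := h4 _ hbad
        rw [hc, mul_div_cancel_left₀ _ h2]
        apply auxP_mem'
        have h5 : M ≤ (s (g j)).natDegree := by
          push Not at hgu
          exact Nat.le_of_mul_le_mul_left (hgu.trans h3) (by omega)
        by_cases hc0 : c = 0
        · rw [hc0, natDegree_zero]; omega
        have hb0 : g x ≠ 0 := by
          intro h; rw [h] at hc; simp at hc; exact hc.elim h2 hc0
        have h6 : (g x).natDegree < N := (natDegree_lt_iff_degree_lt hb0).2 (hdeg x)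
        have h7 := congrArg natDegree hc
        rw [natDegree_mul X_ne_zero hb0, natDegree_mul h2 hc0, natDegree_X] at h7
        omega
      · rw [Function.update_of_ne hx]
        show Function.update g i (X * g i / s (g j)) x ∈ _
        rw [Function.update_of_ne hx, auxP_mem]; exact hdeg x
    · intro g hg g' hg' he
      rw [Finset.mem_coe, Finset.mem_filter] at hg hg'
      obtain ⟨h0, hdeg, hbad⟩ := hB g hg.1
      obtain ⟨h1, h2, h3, h4⟩ := hk (g j) h0
      obtain ⟨h0', hdeg', hbad'⟩ := hB g' hg'.1
      obtain ⟨h1', h2', h3', h4'⟩ := hk (g' j) h0'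
      have hne : ∀ x, x ≠ i → g x = g' x := by
        intro x hx
        have := congrFun he x
        simpa [Function.update_of_ne hx] using this
      funext x
      by_cases hx : x = i
      · subst hx
        have h5 := congrFun he x
        simp only [Function.update_self] at h5
        have hj := hne j hij.symm
        have h6 := h4 _ hbad
        have h7 := h4' _ hbad'
        rw [← hj] at h5 h7
        have h8 : X * g x = X * g' x := by
          rw [← EuclideanDomain.mul_div_cancel' h2 h6, ← EuclideanDomain.mul_div_cancel' h2 h7, h5]
        exact mul_left_cancel₀ X_ne_zero h8
      · exact hne x hx

open Polynomial in
theorem aux_count {F : Type} [Field F] [Fintype F] (p : ℕ) (hp : 2 ≤ p) (r N M : ℕ)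
    (hM : M ≤ N) (hr : 2 ≤ r) (i j : Fin r) (hij : i ≠ j) :
    ∃ bad : ℕ, Fintype.card F ^ (N * (r - 1)) + (Nat.card {g : Fin r → F[X] //
      g j ≠ 0 ∧ (∀ i, (g i).degree < (N : ℕ)) ∧
      ∃ l : F[X], l.Monic ∧ Irreducible l ∧ l ≠ X ∧ ¬ l ∣ g i ∧
        ∃ k : ℕ, ¬ p ∣ k ∧ l ^ k ∣ g j ∧ ¬ l ^ (k + 1) ∣ g j} + bad) =
        Fintype.card F ^ (N * r) ∧
      bad ≤ Fintype.card F ^ (p * M + (N / 2 + 1)) * Fintype.card F ^ (N * (r - 1)) +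
      Fintype.card F ^ (N + 1 - M) * Fintype.card F ^ (N * (r - 1)) := by
  classical
  set A : Finset (Fin r → F[X]) := Fintype.piFinset (fun _ => auxP F N) with hA
  have hmem : ∀ g, g ∈ A ↔ ∀ i, (g i).degree < (N : ℕ) := by
    intro g; rw [hA, Fintype.mem_piFinset]; simp only [auxP_mem]
  set Q : (Fin r → F[X]) → Prop := fun g => ∃ l : F[X], l.Monic ∧ Irreducible l ∧ l ≠ X ∧
    ¬ l ∣ g i ∧ ∃ k : ℕ, ¬ p ∣ k ∧ l ^ k ∣ g j ∧ ¬ l ^ (k + 1) ∣ g j with hQ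
  set A' := A.filter (fun g => ¬ g j = 0) with hA'
  refine ⟨(A'.filter (fun g => ¬ Q g)).card, ?_, ?_⟩
  · rw [Nat.subtype_card (A'.filter Q), Finset.card_filter_add_card_filter_not]
    · have hZ : (A.filter (fun g => g j = 0)) =
          Fintype.piFinset (Function.update (fun _ : Fin r => auxP F N) j {0}) := by
        ext g
        rw [Finset.mem_filter, hmem, Fintype.mem_piFinset]
        constructor
        · rintro ⟨h1, h2⟩ x
          by_cases hx : x = j
          · subst hx; simp [h2]
          · rw [Function.update_of_ne hx, auxP_mem]; exact h1 x
        · intro h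
          have hj : g j = 0 := by simpa using h j
          refine ⟨fun x => ?_, hj⟩
          by_cases hx : x = j
          · rw [hx, hj, degree_zero]; exact WithBot.bot_lt_coe _
          · have := h x
            rwa [Function.update_of_ne hx, auxP_mem] at this
      have h1 := aux_pi_card (N := N) (F := F) j {0}
      rw [← hZ, Finset.card_singleton, one_mul] at h1
      rw [← h1, hA', Finset.card_filter_add_card_filter_not, hA, Fintype.card_piFinset]
      simp [auxP_card, pow_mul]
    · intro g
      rw [Finset.mem_filter, hA', Finset.mem_filter, hmem]
      tauto
  · apply aux_bad p hp r N M hM i j hij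
    intro g hg
    rw [Finset.mem_filter, hA', Finset.mem_filter, hmem] at hg
    exact ⟨hg.1.2, hg.1.1, hg.2⟩

/-- The set Π_r of tuples (g_1,...,g_r) ∈ F_q[T]^r with g_r ≠ 0 for which
there exists a monic irreducible l ≠ T with v_l(g_{r-1}) = 0 and p ∤ v_l(g_r), has
density 1. (Here v_l(g_r) = k is expressed as l^k ∣ g_r and l^{k+1} ∤ g_r.) -/
theorem stmt_13 (p : ℕ) (hp : p.Prime) (q n : ℕ) (hn : 0 < n) (hq : q = p ^ n)
    (hq5 : 5 ≤ q)
    (Fq : Type) [Field Fq] [Fintype Fq] (hcard : Fintype.card Fq = q)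
    (r : ℕ) (hr : 2 ≤ r) :
    Filter.Tendsto
      (fun N : ℕ =>
        (Nat.card {g : Fin r → Polynomial Fq //
            g ⟨r - 1, by omega⟩ ≠ 0 ∧ (∀ i, (g i).degree < (N : ℕ)) ∧
            ∃ l : Polynomial Fq, l.Monic ∧ Irreducible l ∧ l ≠ Polynomial.X ∧
              ¬ l ∣ g ⟨r - 2, by omega⟩ ∧
              ∃ k : ℕ, ¬ p ∣ k ∧ l ^ k ∣ g ⟨r - 1, by omega⟩ ∧
                ¬ l ^ (k + 1) ∣ g ⟨r - 1, by omega⟩} : ℝ) /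
          ((q : ℝ) ^ (r * N) - (q : ℝ) ^ ((r - 1) * N)))
      Filter.atTop (nhds 1) := by
  have hp2 := hp.two_le
  have hij : (⟨r - 2, by omega⟩ : Fin r) ≠ ⟨r - 1, by omega⟩ := by
    intro h; rw [Fin.mk.injEq] at h; omega
  have hc := fun N : ℕ => aux_count (F := Fq) p hp2 r N (N / (4 * p)) (Nat.div_le_self _ _) hr
    ⟨r - 2, by omega⟩ ⟨r - 1, by omega⟩ hij
  rw [hcard] at hc
  choose bad h1 h2 using hc
  have hq0 : (0 : ℝ) < q := by exact_mod_cast (by omega : 0 < q)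
  have hq1 : (5 : ℝ) ≤ q := by exact_mod_cast hq5
  have hMt : Filter.Tendsto (fun N : ℕ => N / (4 * p)) Filter.atTop Filter.atTop :=
    Filter.tendsto_atTop_atTop.2 fun b => ⟨b * (4 * p), fun a ha =>
      (Nat.le_div_iff_mul_le (by omega)).2 ha⟩
  have hlim : Filter.Tendsto (fun N : ℕ => 1 - 4 * (q : ℝ) * ((q : ℝ)⁻¹) ^ (N / (4 * p)))
      Filter.atTop (nhds 1) := by
    have := ((tendsto_pow_atTop_nhds_zero_of_lt_one (r := (q : ℝ)⁻¹) (by positivity)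
      (inv_lt_one_of_one_lt₀ (by linarith))).comp hMt).const_mul (4 * (q : ℝ))
    have := this.const_sub 1
    simpa using this
  have hD : ∀ N : ℕ, 1 ≤ N → (q : ℝ) ^ N * (q : ℝ) ^ (N * (r - 1)) ≤
      2 * ((q : ℝ) ^ (r * N) - (q : ℝ) ^ ((r - 1) * N)) := by
    intro N hN
    have e : (q : ℝ) ^ (r * N) = (q : ℝ) ^ N * (q : ℝ) ^ (N * (r - 1)) := by
      rw [← pow_add]; congr 1
      obtain ⟨t, rfl⟩ : ∃ t, r = t + 1 := ⟨r - 1, by omega⟩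
      simp only [Nat.add_sub_cancel]; ring
    rw [e, mul_comm (r - 1) N]
    have h5 : (q : ℝ) ≤ (q : ℝ) ^ N := le_self_pow₀ (by linarith) (by omega)
    have h6 : (0 : ℝ) < (q : ℝ) ^ (N * (r - 1)) := by positivity
    nlinarith
  have hgood : ∀ N : ℕ, ((Nat.card {g : Fin r → Polynomial Fq //
            g ⟨r - 1, by omega⟩ ≠ 0 ∧ (∀ i, (g i).degree < (N : ℕ)) ∧
            ∃ l : Polynomial Fq, l.Monic ∧ Irreducible l ∧ l ≠ Polynomial.X ∧
              ¬ l ∣ g ⟨r - 2, by omega⟩ ∧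
              ∃ k : ℕ, ¬ p ∣ k ∧ l ^ k ∣ g ⟨r - 1, by omega⟩ ∧
                ¬ l ^ (k + 1) ∣ g ⟨r - 1, by omega⟩} : ℕ) : ℝ) =
      ((q : ℝ) ^ (r * N) - (q : ℝ) ^ ((r - 1) * N)) - bad N := by
    intro N
    have := congrArg (Nat.cast (R := ℝ)) (h1 N)
    push_cast at this
    rw [mul_comm r N, mul_comm (r - 1) N]
    linarith
  have hDpos : ∀ N : ℕ, 1 ≤ N → 0 < ((q : ℝ) ^ (r * N) - (q : ℝ) ^ ((r - 1) * N)) := by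
    intro N hN
    have := hD N hN
    have h6 : (0 : ℝ) < (q : ℝ) ^ N * (q : ℝ) ^ (N * (r - 1)) := by positivity
    linarith
  refine tendsto_of_tendsto_of_tendsto_of_le_of_le' hlim tendsto_const_nhds ?_ ?_
  · filter_upwards [Filter.eventually_ge_atTop 1] with N hN
    rw [hgood N, le_div_iff₀ (hDpos N hN)]
    have hd := hD N hN
    set D := ((q : ℝ) ^ (r * N) - (q : ℝ) ^ ((r - 1) * N))
    set M := N / (4 * p) with hM
    have hMle : M * (4 * p) ≤ N := Nat.div_mul_le_self _ _
    have hMp : M * 2 ≤ M * p := Nat.mul_le_mul_left _ hp2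
    have hMN : M * (4 * p) = 4 * (M * p) := by ring
    have hexp : p * M + (N / 2 + 1) ≤ N + 1 - M := by
      rw [mul_comm p M]; omega
    have hb : bad N ≤ 2 * (q ^ (N + 1 - M) * q ^ (N * (r - 1))) := by
      have := Nat.mul_le_mul_right (q ^ (N * (r - 1)))
        (Nat.pow_le_pow_right (by omega : 0 < q) hexp)
      have h9 := h2 N
      rw [← hM] at h9
      linarith
    have hb' : (bad N : ℝ) ≤ 2 * ((q : ℝ) ^ (N + 1 - M) * (q : ℝ) ^ (N * (r - 1))) := by
      exact_mod_cast hb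
    have he : (q : ℝ) ^ (N + 1 - M) = q * (q : ℝ)⁻¹ ^ M * (q : ℝ) ^ N := by
      rw [pow_sub₀ _ hq0.ne' (by omega), pow_succ, inv_pow]; ring
    have hx : (0 : ℝ) ≤ q * (q : ℝ)⁻¹ ^ M := by positivity
    have := mul_le_mul_of_nonneg_left hd hx
    rw [he] at hb'
    nlinarith
  · filter_upwards [Filter.eventually_ge_atTop 1] with N hN
    rw [hgood N, div_le_one (hDpos N hN)]
    have : (0 : ℝ) ≤ bad N := Nat.cast_nonneg _
    linarith
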